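/- arXiv:math/0405597 — 6 statements merged into one kernel-verified Lean document; each statement's English description precedes it below -/
import Mathlib

section
/- Fix colored permutations (σ',u') of size n' and (σ'',u'') of size n''. Then the set of words w over the colored alphabet A of length n = n'+n'' whose first n' letters have colored standardization (σ',u') and whose last n'' letters have colored standardization (σ'',u'') is equal to the disjoint union, over all τ in the convolution σ' * σ'', of the sets {w ∈ A^n : Std(w) = (τ, u'·u'')}, where u'·u'' denotes concatenation of the color words. (Equivalently, the dual free l-quasi-ribbons satisfy G_{σ',u'} G_{σ'',u''} = Σ_{τ ∈ σ'*σ''} G_{τ,u'·u''}.) -/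
/-- `σ` is the standardization of the word `v` over the ordered alphabet `ℕ`:
for all `i < j`, `σ i < σ j ↔ v i ≤ v j`. -/
def IsStd {n : ℕ} (v : Fin n → ℕ) (σ : Equiv.Perm (Fin n)) : Prop :=
  ∀ i j : Fin n, i < j → (σ i < σ j ↔ v i ≤ v j)

/-- The convolution `σ' * σ''` of two permutations. -/
def Convolution {n' n'' : ℕ} (σ' : Equiv.Perm (Fin n')) (σ'' : Equiv.Perm (Fin n'')) :
    Set (Equiv.Perm (Fin (n' + n''))) :=
  {τ | IsStd (fun i => ((τ (Fin.castAdd n'' i) : Fin (n' + n'')) : ℕ)) σ' ∧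
       IsStd (fun i => ((τ (Fin.natAdd n' i) : Fin (n' + n'')) : ℕ)) σ''}

/-- The set of words over the colored alphabet `ℕ × Fin l` whose colored
standardization is `(σ, u)`. -/
def StdFiber {l n : ℕ} (σ : Equiv.Perm (Fin n)) (u : Fin n → Fin l) :
    Set (Fin n → ℕ × Fin l) :=
  {w | IsStd (fun i => (w i).1) σ ∧ (fun i => (w i).2) = u}

/-- The standardization of a word is the inverse of its stable sorting permutation. -/
theorem isStd_iff_symm_eq_sort {n : ℕ} (v : Fin n → ℕ) (σ : Equiv.Perm (Fin n)) :
    IsStd v σ ↔ σ.symm = Tuple.sort v := by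
  rw [Tuple.eq_sort_iff]
  constructor
  · intro h
    refine ⟨fun i j hij => ?_, fun i j hij hv => ?_⟩
    · have h₁ := h (σ.symm i) (σ.symm j)
      have h₂ := h (σ.symm j) (σ.symm i)
      simp only [Equiv.apply_symm_apply] at h₁ h₂
      simp only [Function.comp_apply]
      rcases lt_trichotomy (σ.symm i) (σ.symm j) with hlt | heq | hgt
      · exact (h₁ hlt).1 (hij.lt_of_ne fun e => hlt.ne (congrArg σ.symm e))
      · rw [heq]
      · exact (not_le.1 fun hle => hij.not_gt ((h₂ hgt).2 hle)).le
    · by_contra hcon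
      have hlt : σ.symm j < σ.symm i :=
        lt_of_le_of_ne (not_lt.1 hcon) fun e => hij.ne' (σ.symm.injective e)
      have h₂ := (h _ _ hlt).2 hv.ge
      simp only [Equiv.apply_symm_apply] at h₂
      exact hij.not_gt h₂
  · rintro ⟨hmono, hstable⟩ i j hij
    constructor
    · intro hlt
      simpa using hmono hlt.le
    · intro hle
      by_contra hcon
      have hlt : σ j < σ i :=
        lt_of_le_of_ne (not_lt.1 hcon) fun e => hij.ne' (σ.injective e)
      have hge : v j ≤ v i := by simpa using hmono hlt.le
      have hji := hstable (σ j) (σ i) hlt (by simpa using le_antisymm hge hle)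
      simp only [Equiv.symm_apply_apply] at hji
      exact hij.not_gt hji

theorem exists_isStd {n : ℕ} (v : Fin n → ℕ) : ∃ σ, IsStd v σ :=
  ⟨(Tuple.sort v).symm, (isStd_iff_symm_eq_sort _ _).2 (Equiv.symm_symm _)⟩

theorem IsStd.unique {n : ℕ} {v : Fin n → ℕ} {σ τ : Equiv.Perm (Fin n)}
    (hσ : IsStd v σ) (hτ : IsStd v τ) : σ = τ :=
  Equiv.symm_bijective.injective <|
    ((isStd_iff_symm_eq_sort _ _).1 hσ).trans ((isStd_iff_symm_eq_sort _ _).1 hτ).symm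

/-- Restricting a word and its standardization to the same subset of positions gives
words with the same standardization. -/
theorem IsStd.comp_strictMono_iff {m n : ℕ} {v : Fin n → ℕ} {τ : Equiv.Perm (Fin n)}
    (hτ : IsStd v τ) {f : Fin m → Fin n} (hf : StrictMono f) (σ : Equiv.Perm (Fin m)) :
    IsStd (fun i => (τ (f i) : ℕ)) σ ↔ IsStd (fun i => v (f i)) σ := by
  refine forall₃_congr fun i j hij => ?_
  have hne : τ (f i) ≠ τ (f j) := fun e => (hf hij).ne (τ.injective e)
  rw [← hτ _ _ (hf hij), Fin.val_fin_le, hne.le_iff_lt]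

/-- The product rule for dual free `l`-quasi-ribbons: the set of words whose first `n'`
letters standardize to `(σ', u')` and whose last `n''` letters standardize to `(σ'', u'')`
is the disjoint union over `τ ∈ σ' * σ''` of the fibers of `(τ, u'·u'')`. -/
theorem colored_std_product_rule (l n' n'' : ℕ)
    (σ' : Equiv.Perm (Fin n')) (u' : Fin n' → Fin l)
    (σ'' : Equiv.Perm (Fin n'')) (u'' : Fin n'' → Fin l) :
    ({w : Fin (n' + n'') → ℕ × Fin l |
        IsStd (fun i => (w (Fin.castAdd n'' i)).1) σ' ∧
        (fun i => (w (Fin.castAdd n'' i)).2) = u' ∧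
        IsStd (fun i => (w (Fin.natAdd n' i)).1) σ'' ∧
        (fun i => (w (Fin.natAdd n' i)).2) = u''}
      = ⋃ τ ∈ Convolution σ' σ'', StdFiber τ (Fin.append u' u''))
    ∧ (Convolution σ' σ'').Pairwise
        (fun τ₁ τ₂ =>
          Disjoint (StdFiber τ₁ (Fin.append u' u'')) (StdFiber τ₂ (Fin.append u' u''))) := by
  have color_iff (w : Fin (n' + n'') → ℕ × Fin l) :
      (fun i => (w i).2) = Fin.append u' u'' ↔
        (fun i => (w (Fin.castAdd n'' i)).2) = u' ∧
          (fun i => (w (Fin.natAdd n' i)).2) = u'' := by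
    simp only [funext_iff, Fin.forall_fin_add, Fin.append_left, Fin.append_right]
  have mem_convolution_iff {v : Fin (n' + n'') → ℕ} {τ : Equiv.Perm (Fin (n' + n''))}
      (hτ : IsStd v τ) : τ ∈ Convolution σ' σ'' ↔
        IsStd (fun i => v (Fin.castAdd n'' i)) σ' ∧
          IsStd (fun i => v (Fin.natAdd n' i)) σ'' :=
    and_congr (hτ.comp_strictMono_iff (Fin.strictMono_castAdd n'') σ')
      (hτ.comp_strictMono_iff (Fin.strictMono_natAdd n') σ'')
  constructor
  · ext w
    simp only [Set.mem_iUnion, exists_prop, StdFiber, Set.mem_ofPred_eq, color_iff]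
    constructor
    · rintro ⟨h', c', h'', c''⟩
      obtain ⟨τ, hτ⟩ := exists_isStd fun i => (w i).1
      exact ⟨τ, (mem_convolution_iff hτ).2 ⟨h', h''⟩, hτ, c', c''⟩
    · rintro ⟨τ, hmem, hτ, c', c''⟩
      obtain ⟨h', h''⟩ := (mem_convolution_iff hτ).1 hmem
      exact ⟨h', c', h'', c''⟩
  · intro τ₁ _ τ₂ _ hne
    exact Set.disjoint_left.2 fun w h₁ h₂ => hne (h₁.1.unique h₂.1)
end

section
/- Let σ' ∈ S_{n'}, σ'' ∈ S_{n''} and τ ∈ S_{n'+n''}. Then τ belongs to the convolution σ' * σ'' if and only if the word τ⁻¹(1) τ⁻¹(2) ⋯ τ⁻¹(n'+n'') is a shuffle of the word σ'⁻¹(1) ⋯ σ'⁻¹(n') and the shifted word (σ''⁻¹(1)+n') ⋯ (σ''⁻¹(n'')+n'). (This convolution–shifted-shuffle duality underlies the self-duality of FQSym^(l) under the pairing ⟨F_{σ,u}, G_{σ',u'}⟩ = δ_{σ,σ'} δ_{u,u'}.) -/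
/-- The word `c` (of length `n' + n''`) is a shuffle of the words `a` and `b`:
the positions can be partitioned into an increasing sequence carrying the letters of
`a` in order and an increasing sequence carrying the letters of `b` in order. -/
def IsShuffle {n' n'' : ℕ} (a : Fin n' → ℕ) (b : Fin n'' → ℕ)
    (c : Fin (n' + n'') → ℕ) : Prop :=
  ∃ (f : Fin n' → Fin (n' + n'')) (g : Fin n'' → Fin (n' + n'')),
    StrictMono f ∧ StrictMono g ∧
    Disjoint (Set.range f) (Set.range g) ∧
    Set.range f ∪ Set.range g = Set.univ ∧
    (∀ i, c (f i) = a i) ∧ (∀ j, c (g j) = b j)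

/-- A permutation is the standardization of a word with distinct letters iff reading the letters
in the order given by its inverse is strictly increasing. -/
theorem isStd_iff_strictMono_comp_inv {n : ℕ} {v : Fin n → ℕ} (hv : Function.Injective v)
    (σ : Equiv.Perm (Fin n)) : IsStd v σ ↔ StrictMono fun i => v (σ⁻¹ i) := by
  constructor
  · intro h i j hij
    have hne : v (σ⁻¹ i) ≠ v (σ⁻¹ j) := fun e => hij.ne (σ⁻¹.injective (hv e))
    rcases lt_trichotomy (σ⁻¹ i) (σ⁻¹ j) with hlt | heq | hgt
    · have := (h _ _ hlt).1 (by simpa using hij)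
      exact lt_of_le_of_ne this hne
    · exact absurd (congrArg v heq) hne
    · have := mt (h _ _ hgt).2 (by simpa using hij.le)
      exact not_le.1 this
  · intro h i j hij
    have key : v i < v j ↔ σ i < σ j := by simpa using h.lt_iff_lt (a := σ i) (b := σ j)
    rw [← key]
    exact ⟨le_of_lt, fun hle => lt_of_le_of_ne hle fun e => hij.ne (hv e)⟩

/-- `τ ∈ σ' * σ''` iff the word `τ⁻¹(1) ⋯ τ⁻¹(n'+n'')` is a shuffle of the word
`σ'⁻¹(1) ⋯ σ'⁻¹(n')` with the word `(σ''⁻¹(1)+n') ⋯ (σ''⁻¹(n'')+n')`. -/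
theorem convolution_iff_shifted_shuffle (n' n'' : ℕ)
    (σ' : Equiv.Perm (Fin n')) (σ'' : Equiv.Perm (Fin n''))
    (τ : Equiv.Perm (Fin (n' + n''))) :
    τ ∈ Convolution σ' σ'' ↔
      IsShuffle (fun i => ((σ'⁻¹ i : Fin n') : ℕ))
        (fun j => ((σ''⁻¹ j : Fin n'') : ℕ) + n')
        (fun k => ((τ⁻¹ k : Fin (n' + n'')) : ℕ)) := by
  have hinj' : Function.Injective fun i : Fin n' => ((τ (Fin.castAdd n'' i) : Fin _) : ℕ) :=
    Fin.val_injective.comp (τ.injective.comp (Fin.castAdd_injective _ _))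
  have hinj'' : Function.Injective fun j : Fin n'' => ((τ (Fin.natAdd n' j) : Fin _) : ℕ) :=
    Fin.val_injective.comp (τ.injective.comp (Fin.natAdd_injective _ _))
  have hmem : τ ∈ Convolution σ' σ'' ↔
      (StrictMono fun i => τ (Fin.castAdd n'' (σ'⁻¹ i))) ∧
        StrictMono fun j => τ (Fin.natAdd n' (σ''⁻¹ j)) :=
    and_congr (isStd_iff_strictMono_comp_inv hinj' σ') (isStd_iff_strictMono_comp_inv hinj'' σ'')
  rw [hmem]
  constructor
  · rintro ⟨hf, hg⟩
    refine ⟨_, _, hf, hg, ?_, ?_, fun i => by simp, fun j => by simp [add_comm]⟩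
    · rw [Set.disjoint_left]
      rintro _ ⟨i, rfl⟩ ⟨j, hj⟩
      have := congrArg Fin.val (τ.injective hj)
      simp only [Fin.val_natAdd, Fin.val_castAdd] at this
      omega
    · refine Set.eq_univ_of_forall fun k => ?_
      obtain ⟨x, rfl⟩ := τ.surjective k
      induction x using Fin.addCases with
      | left i => exact Or.inl ⟨σ' i, by simp⟩
      | right j => exact Or.inr ⟨σ'' j, by simp⟩
  · rintro ⟨f, g, hf, hg, -, -, hfa, hgb⟩
    have hf_eq : f = fun i => τ (Fin.castAdd n'' (σ'⁻¹ i)) := by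
      funext i
      exact Equiv.Perm.inv_eq_iff_eq.1 (Fin.ext (hfa i))
    have hg_eq : g = fun j => τ (Fin.natAdd n' (σ''⁻¹ j)) := by
      funext j
      exact Equiv.Perm.inv_eq_iff_eq.1 (Fin.ext ((hgb j).trans (add_comm _ _)))
    exact ⟨hf_eq ▸ hf, hg_eq ▸ hg⟩
end

section
/- Let c_n denote the number of connected permutations in S_n. Then in the ring of formal power series ℤ[[t]] one has (Σ_{n≥0} n!·tⁿ) · (1 − Σ_{n≥1} c_n·tⁿ) = 1; equivalently, the generating series c(t) = Σ_{n≥1} c_n tⁿ satisfies c(t) = 1 − (Σ_{n≥0} n! tⁿ)⁻¹. -/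
/-- A permutation `σ ∈ S_n` (0-based) is connected if for every `0 < i < n`,
the image under `σ` of `{0, ..., i-1}` is not `{0, ..., i-1}`. -/
def IsConnectedPerm {n : ℕ} (σ : Equiv.Perm (Fin n)) : Prop :=
  ∀ i : ℕ, 0 < i → i < n →
    (σ '' {j : Fin n | (j : ℕ) < i}) ≠ {j : Fin n | (j : ℕ) < i}

/-- `c n` is the number of connected permutations in `S_n`. -/
noncomputable def connectedCount (n : ℕ) : ℕ :=
  Nat.card {σ : Equiv.Perm (Fin n) // IsConnectedPerm σ}

namespace ConnectedPerm

open Equiv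

/-- The initial segment `{0, ..., i-1}` is stable under `σ`. -/
def StableAt {n : ℕ} (σ : Perm (Fin n)) (i : ℕ) : Prop :=
  ∀ j : Fin n, (j : ℕ) < i → (σ j : ℕ) < i

lemma image_eq_iff_stableAt {n : ℕ} (σ : Perm (Fin n)) (i : ℕ) :
    σ '' {j : Fin n | (j : ℕ) < i} = {j : Fin n | (j : ℕ) < i} ↔ StableAt σ i := by
  constructor
  · intro h j hj
    have : σ j ∈ σ '' {j : Fin n | (j : ℕ) < i} := ⟨j, hj, rfl⟩
    rw [h] at this
    exact this
  · intro h
    refine Set.eq_of_subset_of_ncard_le ?_ ?_ (Set.toFinite _)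
    · rintro _ ⟨j, hj, rfl⟩
      exact h j hj
    · rw [Set.ncard_image_of_injective _ σ.injective]

lemma stableAt_self {n : ℕ} (σ : Perm (Fin n)) : StableAt σ n := fun j _ => (σ j).isLt

/-- The length of the shortest nonempty stable initial segment of `σ`. -/
noncomputable def firstBlock {n : ℕ} (σ : Perm (Fin n)) : ℕ :=
  sInf {k | 0 < k ∧ StableAt σ k}

lemma firstBlock_spec {n : ℕ} (hn : 0 < n) (σ : Perm (Fin n)) :
    0 < firstBlock σ ∧ StableAt σ (firstBlock σ) :=
  Nat.sInf_mem (s := {k | 0 < k ∧ StableAt σ k}) ⟨n, hn, stableAt_self σ⟩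

lemma firstBlock_le {n : ℕ} (hn : 0 < n) (σ : Perm (Fin n)) : firstBlock σ ≤ n :=
  Nat.sInf_le ⟨hn, stableAt_self σ⟩

lemma firstBlock_eq_iff {n k : ℕ} (hn : 0 < n) (hk : 0 < k) (σ : Perm (Fin n)) :
    firstBlock σ = k ↔ StableAt σ k ∧ ∀ i, 0 < i → i < k → ¬ StableAt σ i := by
  constructor
  · rintro rfl
    exact ⟨(firstBlock_spec hn σ).2, fun i hi hik h => Nat.notMem_of_lt_sInf hik ⟨hi, h⟩⟩
  · rintro ⟨h, hmin⟩
    refine le_antisymm (Nat.sInf_le ⟨hk, h⟩) (not_lt.1 fun hlt => ?_)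
    exact hmin _ (firstBlock_spec hn σ).1 hlt (firstBlock_spec hn σ).2

/-- The direct sum of two permutations, acting on consecutive blocks. -/
def directSum {k m : ℕ} (p : Perm (Fin k) × Perm (Fin m)) : Perm (Fin (k + m)) :=
  finSumFinEquiv.permCongr (Perm.sumCongrHom (Fin k) (Fin m) p)

lemma directSum_castAdd {k m : ℕ} (p : Perm (Fin k) × Perm (Fin m)) (j : Fin k) :
    directSum p (Fin.castAdd m j) = Fin.castAdd m (p.1 j) := by
  simp [directSum, Equiv.permCongr_apply]

lemma directSum_injective {k m : ℕ} :
    Function.Injective (directSum : Perm (Fin k) × Perm (Fin m) → Perm (Fin (k + m))) :=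
  finSumFinEquiv.permCongr.injective.comp Perm.sumCongrHom_injective

lemma stableAt_directSum_iff {k m i : ℕ} (hi : i ≤ k) (p : Perm (Fin k) × Perm (Fin m)) :
    StableAt (directSum p) i ↔ StableAt p.1 i := by
  constructor
  · intro h j hj
    simpa [directSum_castAdd] using h (Fin.castAdd m j) hj
  · intro h j hj
    obtain ⟨j, rfl⟩ : ∃ j' : Fin k, Fin.castAdd m j' = j := ⟨⟨j, hj.trans_le hi⟩, rfl⟩
    simpa [directSum_castAdd] using h j hj

lemma exists_directSum_eq {k m : ℕ} {σ : Perm (Fin (k + m))} (h : StableAt σ k) :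
    ∃ p, directSum p = σ := by
  obtain ⟨p, hp⟩ : finSumFinEquiv.permCongr.symm σ ∈
      (Perm.sumCongrHom (Fin k) (Fin m)).range := by
    apply Perm.mem_sumCongrHom_range_of_perm_mapsTo_inl
    rintro _ ⟨j, rfl⟩
    have hj := h (Fin.castAdd m j) (by simp)
    refine ⟨⟨_, hj⟩, finSumFinEquiv.injective ?_⟩
    ext
    simp [Equiv.permCongr_symm, Equiv.permCongr_apply]
  exact ⟨p, by rw [directSum, hp, Equiv.apply_symm_apply]⟩

lemma isConnectedPerm_iff {n : ℕ} (σ : Perm (Fin n)) :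
    IsConnectedPerm σ ↔ ∀ i, 0 < i → i < n → ¬ StableAt σ i := by
  simp only [IsConnectedPerm, ne_eq, image_eq_iff_stableAt]

lemma firstBlock_directSum_eq_iff {k m : ℕ} (hk : 0 < k) (p : Perm (Fin k) × Perm (Fin m)) :
    firstBlock (directSum p) = k ↔ IsConnectedPerm p.1 := by
  rw [firstBlock_eq_iff (by omega) hk, isConnectedPerm_iff, stableAt_directSum_iff le_rfl]
  refine ⟨fun h i hi hik => ?_, fun h => ⟨stableAt_self _, fun i hi hik => ?_⟩⟩
  · rw [← stableAt_directSum_iff hik.le p]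
    exact h.2 i hi hik
  · rw [stableAt_directSum_iff hik.le]
    exact h i hi hik

lemma card_firstBlock_eq {k m : ℕ} (hk : 0 < k) :
    Nat.card {σ : Perm (Fin (k + m)) // firstBlock σ = k} = connectedCount k * m.factorial := by
  have hm : Nat.card (Perm (Fin m)) = m.factorial := by
    rw [Nat.card_perm, Nat.card_fin]
  rw [connectedCount, ← hm, ← Nat.card_prod]
  symm
  refine Nat.card_eq_of_bijective
    (fun q => ⟨directSum (q.1.1, q.2), (firstBlock_directSum_eq_iff hk _).2 q.1.2⟩) ⟨?_, ?_⟩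
  · rintro ⟨⟨a, ha⟩, b⟩ ⟨⟨a', ha'⟩, b'⟩ h
    have := directSum_injective (Subtype.ext_iff.1 h)
    simpa using this
  · rintro ⟨σ, hσ⟩
    obtain ⟨p, rfl⟩ := exists_directSum_eq ((firstBlock_eq_iff (by omega) hk σ).1 hσ).1
    exact ⟨(⟨p.1, (firstBlock_directSum_eq_iff hk p).1 hσ⟩, p.2), rfl⟩

/-- Decomposing permutations according to their first block. -/
lemma factorial_eq_sum_connectedCount {n : ℕ} (hn : 0 < n) :
    n.factorial = ∑ p ∈ Finset.HasAntidiagonal.antidiagonal n,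
      (if p.1 = 0 then 0 else connectedCount p.1) * p.2.factorial := by
  classical
  have hcard : n.factorial = (Finset.univ : Finset (Perm (Fin n))).card := by
    rw [Finset.card_univ, Fintype.card_perm, Fintype.card_fin]
  rw [hcard, Finset.card_eq_sum_card_fiberwise
    (f := fun σ => (firstBlock σ, n - firstBlock σ)) (t := Finset.HasAntidiagonal.antidiagonal n)]
  · refine Finset.sum_congr rfl ?_
    rintro ⟨k, m⟩ hkm
    obtain rfl : k + m = n := Finset.HasAntidiagonal.mem_antidiagonal.1 hkm
    have hfib (σ : Perm (Fin (k + m))) :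
        (firstBlock σ, k + m - firstBlock σ) = (k, m) ↔ firstBlock σ = k := by
      rw [Prod.mk.injEq]
      omega
    simp only [hfib]
    split_ifs with hk
    · rw [zero_mul, Finset.card_eq_zero, Finset.filter_eq_empty_iff]
      intro σ _
      have := (firstBlock_spec hn σ).1
      omega
    · rw [← card_firstBlock_eq (Nat.pos_of_ne_zero hk), Nat.card_eq_fintype_card,
        Fintype.card_subtype]
  · intro σ _
    have := firstBlock_le hn σ
    simp only [Finset.mem_coe, Finset.HasAntidiagonal.mem_antidiagonal]
    omega

end ConnectedPerm

/-- The generating series identity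
`(Σ_{n≥0} n! tⁿ) · (1 − Σ_{n≥1} c_n tⁿ) = 1` in `ℤ[[t]]`, i.e.
`c(t) = 1 − (Σ_{n≥0} n! tⁿ)⁻¹`. -/
theorem connected_permutations_generating_series :
    (PowerSeries.mk fun n => (n.factorial : ℤ)) *
      (1 - PowerSeries.mk fun n => if n = 0 then 0 else (connectedCount n : ℤ)) = 1 := by
  rw [mul_comm, sub_mul, one_mul]
  ext n
  rw [map_sub, PowerSeries.coeff_mul, PowerSeries.coeff_one]
  simp only [PowerSeries.coeff_mk]
  split_ifs with hn
  · simp [hn]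
  · rw [sub_eq_zero, ConnectedPerm.factorial_eq_sum_connectedCount (Nat.pos_of_ne_zero hn)]
    push_cast
    rfl
end

section
/- Fix an integer l ≥ 1 and let a_n denote the number of l-compositions (vector compositions) of weight n, of any length (with a_0 = 1, counting the empty matrix). Then in ℤ[[t]] one has (2(1−t)^l − 1) · (Σ_{n≥0} a_n tⁿ) = (1−t)^l; equivalently Σ_{n≥0} a_n tⁿ = (1−t)^l / (2(1−t)^l − 1). (This is the Hilbert series of Sym^(l), whose basis S^I is indexed by l-compositions.) -/
/-- An `l`-composition, encoded as the list of its columns (each a vector in `ℕ^l`):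
no column is zero. -/
def IsLComp (l : ℕ) (L : List (Fin l → ℕ)) : Prop :=
  ∀ c ∈ L, c ≠ 0

/-- The weight of an `l`-composition: the sum of all its entries. -/
def lcompWeight {l : ℕ} (L : List (Fin l → ℕ)) : ℕ :=
  (L.map fun c => ∑ i, c i).sum

/-- `a n` is the number of `l`-compositions of weight `n` (of any length). -/
noncomputable def lcompCount (l n : ℕ) : ℕ :=
  Nat.card {L : List (Fin l → ℕ) // IsLComp l L ∧ lcompWeight L = n}

open PowerSeries Finset in
/-- The generating series of vectors in `ℕ^l` by weight is inverse to `(1 - X) ^ l`. -/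
theorem mk_card_piAntidiag_mul_one_sub_pow (l : ℕ) :
    (PowerSeries.mk fun n => (#(piAntidiag (univ : Finset (Fin l)) n) : ℤ)) * (1 - X) ^ l = 1 := by
  have h : (PowerSeries.mk fun n => (#(piAntidiag (univ : Finset (Fin l)) n) : ℤ)) =
      (PowerSeries.mk 1) ^ l := by
    have hprod : (PowerSeries.mk 1 : ℤ⟦X⟧) ^ l = ∏ _i : Fin l, PowerSeries.mk 1 := by simp
    ext n
    rw [hprod, coeff_prod]
    simp [finsuppAntidiag]
  rw [h, ← mul_pow, mk_one_mul_one_sub_eq_one, one_pow]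

/-- The nonzero vectors in `ℕ^l` of weight `k`. -/
def nonzeroColumns (l k : ℕ) : Finset (Fin l → ℕ) :=
  (Finset.piAntidiag Finset.univ k).erase 0

theorem mem_nonzeroColumns {l k : ℕ} {c : Fin l → ℕ} :
    c ∈ nonzeroColumns l k ↔ c ≠ 0 ∧ ∑ i, c i = k := by
  simp [nonzeroColumns]

theorem card_nonzeroColumns_add (l k : ℕ) :
    (nonzeroColumns l k).card + (if k = 0 then 1 else 0) =
      (Finset.piAntidiag (Finset.univ : Finset (Fin l)) k).card := by
  rcases eq_or_ne k 0 with rfl | hk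
  · simp [nonzeroColumns]
  · rw [nonzeroColumns, Finset.erase_eq_of_notMem]
    · simp [hk]
    · simpa using hk.symm

theorem sum_pos_of_ne_zero {l : ℕ} {c : Fin l → ℕ} (hc : c ≠ 0) : 0 < ∑ i, c i := by
  refine Nat.pos_of_ne_zero fun h => hc (funext fun i => ?_)
  exact Finset.sum_eq_zero_iff.mp h i (Finset.mem_univ i)

theorem isLComp_nil (l : ℕ) : IsLComp l [] := by simp [IsLComp]

theorem isLComp_cons {l : ℕ} {c : Fin l → ℕ} {L : List (Fin l → ℕ)} :
    IsLComp l (c :: L) ↔ c ≠ 0 ∧ IsLComp l L := by simp [IsLComp]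

theorem lcompWeight_nil {l : ℕ} : lcompWeight ([] : List (Fin l → ℕ)) = 0 := rfl

theorem lcompWeight_cons {l : ℕ} (c : Fin l → ℕ) (L : List (Fin l → ℕ)) :
    lcompWeight (c :: L) = ∑ i, c i + lcompWeight L := by simp [lcompWeight]

theorem finite_lcomp (l n : ℕ) : {L | IsLComp l L ∧ lcompWeight L = n}.Finite := by
  induction n using Nat.strong_induction_on with
  | _ n ih =>
    have hfin : ({[]} ∪ ⋃ k ∈ Set.Iio n, Set.image2 List.cons
        (nonzeroColumns l (n - k) : Set (Fin l → ℕ))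
        {L | IsLComp l L ∧ lcompWeight L = k}).Finite :=
      (Set.finite_singleton _).union <| (Set.finite_Iio n).biUnion fun k hk =>
        (Finset.finite_toSet _).image2 _ (ih k hk)
    refine hfin.subset ?_
    rintro (_ | ⟨c, L⟩) ⟨hL, hw⟩
    · simp
    · rw [isLComp_cons] at hL
      rw [lcompWeight_cons] at hw
      have hpos := sum_pos_of_ne_zero hL.1
      refine Or.inr (Set.mem_biUnion (x := lcompWeight L) (by simp; omega) ?_)
      exact Set.mem_image2_of_mem (mem_nonzeroColumns.mpr ⟨hL.1, by omega⟩) ⟨hL.2, rfl⟩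

/-- The `l`-compositions of weight `n`. -/
noncomputable def lcomps (l n : ℕ) : Finset (List (Fin l → ℕ)) := (finite_lcomp l n).toFinset

theorem mem_lcomps {l n : ℕ} {L : List (Fin l → ℕ)} :
    L ∈ lcomps l n ↔ IsLComp l L ∧ lcompWeight L = n := by simp [lcomps]

theorem card_lcomps (l n : ℕ) : (lcomps l n).card = lcompCount l n :=
  (Nat.subtype_card _ fun _ => mem_lcomps).symm

open Finset in
/-- Splitting off the first column of a nonempty `l`-composition. -/
theorem lcomps_eq (l n : ℕ) :
    lcomps l n = (if n = 0 then {[]} else ∅) ∪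
      (antidiagonal n).biUnion fun p => image₂ List.cons (nonzeroColumns l p.1) (lcomps l p.2) := by
  ext (_ | ⟨c, L⟩)
  · by_cases hn : n = 0 <;>
      simp [mem_lcomps, isLComp_nil, lcompWeight_nil, hn, eq_comm]
  · have hcons : c :: L ∉ (if n = 0 then {[]} else ∅ : Finset (List (Fin l → ℕ))) := by
      split_ifs <;> simp
    simp only [mem_union, hcons, false_or, mem_biUnion, mem_image₂,
      HasAntidiagonal.mem_antidiagonal, mem_lcomps, mem_nonzeroColumns, isLComp_cons, lcompWeight_cons,
      List.cons.injEq]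
    constructor
    · rintro ⟨⟨hc, hL⟩, hw⟩
      exact ⟨(_, _), hw, c, ⟨hc, rfl⟩, L, ⟨hL, rfl⟩, rfl, rfl⟩
    · rintro ⟨p, hp, _, ⟨hc, hcw⟩, _, ⟨hL, hLw⟩, rfl, rfl⟩
      exact ⟨⟨hc, hL⟩, by omega⟩

open Finset in
theorem lcompCount_eq (l n : ℕ) :
    lcompCount l n = (if n = 0 then 1 else 0) +
      ∑ p ∈ antidiagonal n, #(nonzeroColumns l p.1) * lcompCount l p.2 := by
  rw [← card_lcomps, lcomps_eq, card_union_of_disjoint, card_biUnion]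
  · congr 1
    · split_ifs <;> simp
    · refine sum_congr rfl fun p _ => ?_
      rw [card_image₂, card_lcomps]
      exact fun _ _ _ _ h => List.cons.inj h
  · intro p _ q _ hpq
    refine disjoint_left.mpr fun L hp hq => hpq ?_
    simp only [mem_image₂, mem_lcomps, mem_nonzeroColumns] at hp hq
    obtain ⟨c, ⟨-, hc⟩, L', ⟨-, hL⟩, rfl⟩ := hp
    obtain ⟨d, ⟨-, hd⟩, M, ⟨-, hM⟩, h⟩ := hq
    obtain ⟨rfl, rfl⟩ := List.cons.inj h
    exact Prod.ext (hc.symm.trans hd) (hL.symm.trans hM)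
  · split_ifs <;> simp [disjoint_left]

/-- The Hilbert series of `Sym^(l)`:
`(2(1−t)^l − 1) · Σ_{n≥0} a_n tⁿ = (1−t)^l` in `ℤ[[t]]`. -/
theorem lcomp_generating_series (l : ℕ) (hl : 1 ≤ l) :
    (2 * (1 - PowerSeries.X) ^ l - 1) *
        (PowerSeries.mk fun n => (lcompCount l n : ℤ)) =
      (1 - PowerSeries.X) ^ l := by
  have hC := mk_card_piAntidiag_mul_one_sub_pow l
  have hD : (PowerSeries.mk fun n => ((nonzeroColumns l n).card : ℤ)) + 1 =
      PowerSeries.mk fun n =>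
        ((Finset.piAntidiag (Finset.univ : Finset (Fin l)) n).card : ℤ) := by
    ext n
    rw [map_add, PowerSeries.coeff_mk, PowerSeries.coeff_mk, PowerSeries.coeff_one,
      ← card_nonzeroColumns_add]
    push_cast
    rfl
  have hA : (PowerSeries.mk fun n => (lcompCount l n : ℤ)) =
      1 + (PowerSeries.mk fun n => ((nonzeroColumns l n).card : ℤ)) *
        PowerSeries.mk fun n => (lcompCount l n : ℤ) := by
    ext n
    rw [map_add, PowerSeries.coeff_mul, PowerSeries.coeff_one, PowerSeries.coeff_mk,
      lcompCount_eq]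
    simp
  rw [← hD] at hC
  linear_combination (1 - PowerSeries.X) ^ l * hA +
    (PowerSeries.mk fun n => (lcompCount l n : ℤ)) * hC
end

section
/- For any two l-compositions I and J, the product M_I · M_J in the formal power series ring is a finite linear combination with nonnegative integer coefficients of functions M_K, where K ranges over l-compositions of weight equal to the sum of the weights of I and J. Consequently the level-l monomial quasi-symmetric functions span a subalgebra QSym^(l) of the power series ring. -/
open Classical in
/-- The level-`l` monomial quasi-symmetric function `M_I`, for an `l`-composition `I`
given as its list of columns, as a formal power series in the commuting variables
`x_j^{(c)}` (indexed by pairs `(j, c) : ℕ × ℕ` with `c < l`): the sum over strictly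
increasing row indices `j_1 < ⋯ < j_m` of the monomials `∏_k ∏_c (x_{j_k}^{(c)})^{(i_k)_c}`. -/
noncomputable def Mqs (l : ℕ) (L : List (Fin l → ℕ)) : MvPowerSeries (ℕ × ℕ) ℚ :=
  fun d =>
    if ∃ j : Fin L.length → ℕ, StrictMono j ∧
        d = ∑ k : Fin L.length, ∑ c : Fin l,
              Finsupp.single (j k, (c : ℕ)) (L.get k c)
    then 1 else 0

namespace Mqs

open Finset.HasAntidiagonal (antidiagonal mem_antidiagonal)

variable {l m : ℕ}

/-- The exponent of the monomial with column `A k` placed at the row index `j k`. -/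
noncomputable def exponent (j : Fin m → ℕ) (A : Fin m → Fin l → ℕ) : ℕ × ℕ →₀ ℕ :=
  ∑ k, ∑ c : Fin l, Finsupp.single (j k, (c : ℕ)) (A k c)

/-- The columns of an exponent at the row indices `j k`. -/
def columns (l : ℕ) (j : Fin m → ℕ) (d : ℕ × ℕ →₀ ℕ) : Fin m → Fin l → ℕ :=
  fun k c => d (j k, (c : ℕ))

/-- The exponents of the monomials that occur in `Mqs l L`. -/
def Occurs (L : List (Fin l → ℕ)) (d : ℕ × ℕ →₀ ℕ) : Prop :=
  ∃ j : Fin L.length → ℕ, StrictMono j ∧ d = exponent j L.get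

open Classical in
theorem coeff_eq (L : List (Fin l → ℕ)) (d : ℕ × ℕ →₀ ℕ) :
    MvPowerSeries.coeff d (Mqs l L) = if Occurs L d then 1 else 0 := rfl

theorem columns_exponent {j : Fin m → ℕ} (hj : Function.Injective j) (A : Fin m → Fin l → ℕ) :
    columns l j (exponent j A) = A := by
  ext k c
  simp only [columns, exponent, Finsupp.finsetSum_apply, Finsupp.single_apply, Prod.mk.injEq,
    hj.eq_iff, Fin.val_inj]
  rw [Finset.sum_eq_single k (by intro b _ hb; simp [hb]) (by simp)]
  simp

theorem exists_of_exponent_ne_zero {j : Fin m → ℕ} {A : Fin m → Fin l → ℕ} {p : ℕ × ℕ}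
    (h : exponent j A p ≠ 0) : ∃ (k : Fin m) (c : Fin l), p = (j k, (c : ℕ)) ∧ A k c ≠ 0 := by
  simp only [exponent, Finsupp.finsetSum_apply] at h
  obtain ⟨k, -, hk⟩ := Finset.exists_ne_zero_of_sum_ne_zero h
  obtain ⟨c, -, hc⟩ := Finset.exists_ne_zero_of_sum_ne_zero hk
  rw [Finsupp.single_apply] at hc
  split_ifs at hc with hp
  · exact ⟨k, c, hp.symm, hc⟩
  · exact absurd rfl hc

theorem exponent_columns {j : Fin m → ℕ} (hj : Function.Injective j) {d : ℕ × ℕ →₀ ℕ}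
    (hd : ∀ p, d p ≠ 0 → ∃ (k : Fin m) (c : Fin l), p = (j k, (c : ℕ))) :
    exponent j (columns l j d) = d := by
  have key (k : Fin m) (c : Fin l) : exponent j (columns l j d) (j k, (c : ℕ)) = d (j k, (c : ℕ)) :=
    congrFun (congrFun (columns_exponent hj (columns l j d)) k) c
  ext p
  by_cases hp : ∃ (k : Fin m) (c : Fin l), p = (j k, (c : ℕ))
  · obtain ⟨k, c, rfl⟩ := hp
    exact key k c
  · rw [not_not.1 (mt (hd p) hp)]
    by_contra h
    obtain ⟨k, c, hk, -⟩ := exists_of_exponent_ne_zero h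
    exact hp ⟨k, c, hk⟩

theorem exponent_columns_of_le {j : Fin m → ℕ} (hj : Function.Injective j)
    {A : Fin m → Fin l → ℕ} {d : ℕ × ℕ →₀ ℕ} (hd : d ≤ exponent j A) :
    exponent j (columns l j d) = d := by
  refine exponent_columns hj fun p hp => ?_
  have h : exponent j A p ≠ 0 := fun h0 => hp (Nat.eq_zero_of_le_zero (h0 ▸ hd p))
  obtain ⟨k, c, hk, -⟩ := exists_of_exponent_ne_zero h
  exact ⟨k, c, hk⟩

theorem exponent_add (j : Fin m → ℕ) (A B : Fin m → Fin l → ℕ) :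
    exponent j (A + B) = exponent j A + exponent j B := by
  simp [exponent, Finset.sum_add_distrib]

theorem columns_add (j : Fin m → ℕ) (a b : ℕ × ℕ →₀ ℕ) :
    columns l j (a + b) = columns l j a + columns l j b := rfl

theorem degree_exponent (j : Fin m → ℕ) (A : Fin m → Fin l → ℕ) :
    (exponent j A).degree = ∑ k, ∑ c, A k c := by
  simp [exponent, map_sum]

theorem Occurs.degree_eq {L : List (Fin l → ℕ)} {d : ℕ × ℕ →₀ ℕ} (h : Occurs L d) :
    d.degree = lcompWeight L := by
  obtain ⟨j, -, rfl⟩ := h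
  rw [degree_exponent, lcompWeight]
  exact Fin.sum_univ_fun_getElem L fun c => ∑ i, c i

theorem Occurs.snd_lt {L : List (Fin l → ℕ)} {d : ℕ × ℕ →₀ ℕ} (h : Occurs L d)
    {p : ℕ × ℕ} (hp : d p ≠ 0) : p.2 < l := by
  obtain ⟨j, -, rfl⟩ := h
  obtain ⟨k, c, rfl, -⟩ := exists_of_exponent_ne_zero hp
  exact c.2

theorem occurs_ofFn {j : Fin m → ℕ} (hj : StrictMono j) (A : Fin m → Fin l → ℕ) :
    Occurs (List.ofFn A) (exponent j A) := by
  have hm : (List.ofFn A).length = m := List.length_ofFn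
  refine ⟨j ∘ Fin.cast hm, fun a b hab => hj hab, ?_⟩
  refine (Fintype.sum_equiv (finCongr hm) _ _ fun k => ?_).symm
  simp only [finCongr_apply, Function.comp_apply, List.get_ofFn]

/-- Occurrence in `Mqs l L` depends only on the columns and not on the rows they sit in. -/
theorem Occurs.exponent_congr {L : List (Fin l → ℕ)} (hL : IsLComp l L) {j j' : Fin m → ℕ}
    (hj : StrictMono j) (hj' : StrictMono j') {A : Fin m → Fin l → ℕ}
    (h : Occurs L (exponent j A)) : Occurs L (exponent j' A) := by
  obtain ⟨i, hi, h⟩ := h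
  have hex (k : Fin L.length) : ∃ t, j t = i k := by
    obtain ⟨c, hc⟩ := Function.ne_iff.1 (hL _ (L.get_mem k))
    have hne : exponent j A (i k, (c : ℕ)) ≠ 0 := by
      rw [h]
      exact (congrFun (congrFun (columns_exponent hi.injective L.get) k) c).trans_ne hc
    obtain ⟨t, c', ht, -⟩ := exists_of_exponent_ne_zero hne
    exact ⟨t, (Prod.ext_iff.1 ht).1.symm⟩
  choose t ht using hex
  have htmono : StrictMono t := fun a b hab => by
    rw [← hj.lt_iff_lt, ht, ht]
    exact hi hab
  refine ⟨j' ∘ t, hj'.comp htmono, ?_⟩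
  have spread (i' : Fin m → ℕ) : exponent (i' ∘ t) L.get =
      exponent i' (fun s c => ∑ k, if t k = s then L.get k c else 0) := by
    simp only [exponent, Function.comp_apply, Finsupp.single_finsetSum]
    refine Eq.trans ?_ (Finset.sum_congr rfl fun s _ => Finset.sum_comm)
    rw [Finset.sum_comm (s := (Finset.univ : Finset (Fin m)))]
    refine Finset.sum_congr rfl fun k _ => ?_
    rw [Finset.sum_eq_single (t k) (by intro b _ hb; simp [hb.symm]) (by simp)]
    simp
  have hA : A = fun s c => ∑ k, if t k = s then L.get k c else 0 := by
    rw [← columns_exponent hj.injective A, h, ← (funext ht : j ∘ t = i), spread,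
      columns_exponent hj.injective]
  rw [spread, ← hA]

theorem coeff_exponent_congr {L : List (Fin l → ℕ)} (hL : IsLComp l L) {j j' : Fin m → ℕ}
    (hj : StrictMono j) (hj' : StrictMono j') (A : Fin m → Fin l → ℕ) :
    MvPowerSeries.coeff (exponent j A) (Mqs l L) =
      MvPowerSeries.coeff (exponent j' A) (Mqs l L) := by
  classical
  have h : Occurs L (exponent j A) ↔ Occurs L (exponent j' A) :=
    ⟨fun h => h.exponent_congr hL hj hj', fun h => h.exponent_congr hL hj' hj⟩
  simp only [coeff_eq, h]

/-- The coefficients of `Mqs l I * Mqs l J` are quasi-symmetric. -/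
theorem coeff_mul_exponent_congr {I J : List (Fin l → ℕ)} (hI : IsLComp l I) (hJ : IsLComp l J)
    {j j' : Fin m → ℕ} (hj : StrictMono j) (hj' : StrictMono j') (A : Fin m → Fin l → ℕ) :
    MvPowerSeries.coeff (exponent j A) (Mqs l I * Mqs l J) =
      MvPowerSeries.coeff (exponent j' A) (Mqs l I * Mqs l J) := by
  classical
  have maps {i i' : Fin m → ℕ} (hi : StrictMono i) {p : (ℕ × ℕ →₀ ℕ) × (ℕ × ℕ →₀ ℕ)}
      (hp : p ∈ antidiagonal (exponent i A)) :
      (exponent i' (columns l i p.1), exponent i' (columns l i p.2)) ∈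
        antidiagonal (exponent i' A) := by
    rw [mem_antidiagonal] at hp ⊢
    rw [← exponent_add, ← columns_add, hp, columns_exponent hi.injective]
  have fst_inv {i : Fin m → ℕ} (hi : StrictMono i) {p : (ℕ × ℕ →₀ ℕ) × (ℕ × ℕ →₀ ℕ)}
      (hp : p ∈ antidiagonal (exponent i A)) : exponent i (columns l i p.1) = p.1 :=
    exponent_columns_of_le hi.injective (le_self_add.trans_eq (mem_antidiagonal.1 hp))
  have snd_inv {i : Fin m → ℕ} (hi : StrictMono i) {p : (ℕ × ℕ →₀ ℕ) × (ℕ × ℕ →₀ ℕ)}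
      (hp : p ∈ antidiagonal (exponent i A)) : exponent i (columns l i p.2) = p.2 :=
    exponent_columns_of_le hi.injective (le_add_self.trans_eq (mem_antidiagonal.1 hp))
  rw [MvPowerSeries.coeff_mul, MvPowerSeries.coeff_mul]
  refine Finset.sum_nbij'
    (fun p => (exponent j' (columns l j p.1), exponent j' (columns l j p.2)))
    (fun p => (exponent j (columns l j' p.1), exponent j (columns l j' p.2)))
    (fun p hp => maps hj hp) (fun p hp => maps hj' hp) (fun p hp => ?_) (fun p hp => ?_)
    (fun p hp => ?_)
  · simp only [columns_exponent hj'.injective, fst_inv hj hp, snd_inv hj hp]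
  · simp only [columns_exponent hj.injective, fst_inv hj' hp, snd_inv hj' hp]
  · rw [← coeff_exponent_congr hI hj hj', ← coeff_exponent_congr hJ hj hj', fst_inv hj hp,
      snd_inv hj hp]

theorem exists_coeff_mul_eq_natCast (I J : List (Fin l → ℕ)) (d : ℕ × ℕ →₀ ℕ) :
    ∃ n : ℕ, MvPowerSeries.coeff d (Mqs l I * Mqs l J) = n := by
  classical
  refine ⟨∑ p ∈ antidiagonal d,
    (if Occurs I p.1 then 1 else 0) * (if Occurs J p.2 then 1 else 0), ?_⟩
  simp [MvPowerSeries.coeff_mul, coeff_eq]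

theorem exists_occurs_of_coeff_mul_ne_zero {I J : List (Fin l → ℕ)} {d : ℕ × ℕ →₀ ℕ}
    (h : MvPowerSeries.coeff d (Mqs l I * Mqs l J) ≠ 0) :
    ∃ a b, a + b = d ∧ Occurs I a ∧ Occurs J b := by
  classical
  rw [MvPowerSeries.coeff_mul] at h
  obtain ⟨p, hp, hne⟩ := Finset.exists_ne_zero_of_sum_ne_zero h
  refine ⟨p.1, p.2, mem_antidiagonal.1 hp, ?_, ?_⟩
  · by_contra hI
    simp [coeff_eq, hI] at hne
  · by_contra hJ
    simp [coeff_eq, hJ] at hne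

/-- Every exponent in the variables of level `l` occurs in some monomial function. -/
theorem exists_isLComp_occurs {d : ℕ × ℕ →₀ ℕ} (hd : ∀ p, d p ≠ 0 → p.2 < l) :
    ∃ K, IsLComp l K ∧ Occurs K d := by
  classical
  set T := d.support.image Prod.fst
  set j := T.orderEmbOfFin rfl
  have hrange : Set.range j = T := T.range_orderEmbOfFin rfl
  refine ⟨List.ofFn (columns l j d), fun c hc => ?_, ?_⟩
  · obtain ⟨k, rfl⟩ := (List.mem_ofFn' _ _).1 hc
    have hk : j k ∈ T := T.orderEmbOfFin_mem rfl k
    obtain ⟨p, hp, hpk⟩ := Finset.mem_image.1 hk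
    rw [Finsupp.mem_support_iff] at hp
    refine Function.ne_iff.2 ⟨⟨p.2, hd p hp⟩, ?_⟩
    simpa [columns, ← hpk] using hp
  · have h := occurs_ofFn j.strictMono (columns l j d)
    rwa [exponent_columns j.injective fun p hp => ?_] at h
    have hp1 : p.1 ∈ Set.range j := by
      rw [hrange]
      exact Finset.mem_coe.2 (Finset.mem_image_of_mem _ (Finsupp.mem_support_iff.2 hp))
    obtain ⟨k, hk⟩ := hp1
    exact ⟨k, ⟨p.2, hd p hp⟩, Prod.ext hk.symm rfl⟩

theorem range_eq_of_forall_ne_zero {j : Fin m → ℕ} (hj : Function.Injective j)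
    {A : Fin m → Fin l → ℕ} (hA : ∀ k, A k ≠ 0) :
    Set.range j = {x | ∃ y, exponent j A (x, y) ≠ 0} := by
  ext x
  constructor
  · rintro ⟨k, rfl⟩
    obtain ⟨c, hc⟩ := Function.ne_iff.1 (hA k)
    exact ⟨c, (congrFun (congrFun (columns_exponent hj A) k) c).trans_ne hc⟩
  · rintro ⟨y, hy⟩
    obtain ⟨k, c, hk, -⟩ := exists_of_exponent_ne_zero hy
    exact ⟨k, (Prod.ext_iff.1 hk).1.symm⟩

theorem ofFn_eq_of_exponent_eq {m' : ℕ} {j : Fin m → ℕ} {j' : Fin m' → ℕ} (hj : StrictMono j)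
    (hj' : StrictMono j') {A : Fin m → Fin l → ℕ} {A' : Fin m' → Fin l → ℕ} (hA : ∀ k, A k ≠ 0)
    (hA' : ∀ k, A' k ≠ 0) (h : exponent j A = exponent j' A') : List.ofFn A = List.ofFn A' := by
  have hr : Set.range j = Set.range j' := by
    rw [range_eq_of_forall_ne_zero hj.injective hA, h,
      ← range_eq_of_forall_ne_zero hj'.injective hA']
  obtain rfl : m = m' := by
    simpa [Set.ncard_range_of_injective, hj.injective, hj'.injective] using congrArg Set.ncard hr
  obtain rfl : j = j' := (hj.range_inj hj').1 hr
  rw [← columns_exponent hj.injective A, h, columns_exponent hj.injective]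

theorem Occurs.eq {K L : List (Fin l → ℕ)} (hK : IsLComp l K) (hL : IsLComp l L)
    {d : ℕ × ℕ →₀ ℕ} (h : Occurs K d) (h' : Occurs L d) : K = L := by
  obtain ⟨j, hj, rfl⟩ := h
  obtain ⟨j', hj', h⟩ := h'
  simpa using ofFn_eq_of_exponent_eq hj hj' (fun k => hK _ (K.get_mem k))
    (fun k => hL _ (L.get_mem k)) h

theorem finite_isLComp_weight (l n : ℕ) :
    {K : List (Fin l → ℕ) | IsLComp l K ∧ lcompWeight K = n}.Finite := by
  refine ((List.finite_length_le (Fin l → Fin (n + 1)) n).image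
    (List.map fun c i => (c i : ℕ))).subset ?_
  rintro K ⟨hK, hn⟩
  have hlen : K.length ≤ n := by
    rw [← hn, lcompWeight, ← List.length_map (as := K) (f := fun c => ∑ i, c i)]
    refine List.length_le_sum_of_one_le _ fun x hx => ?_
    obtain ⟨c, hc, rfl⟩ := List.mem_map.1 hx
    obtain ⟨i, hi⟩ := Function.ne_iff.1 (hK c hc)
    exact (Nat.one_le_iff_ne_zero.2 hi).trans
      (Finset.single_le_sum (fun _ _ => Nat.zero_le _) (Finset.mem_univ i))
  have hle (c) (hc : c ∈ K) (i : Fin l) : c i < n + 1 := by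
    refine Nat.lt_succ_of_le ((Finset.single_le_sum (fun _ _ => Nat.zero_le _)
      (Finset.mem_univ i)).trans ?_)
    rw [← hn]
    exact List.single_le_sum (by simp) _ (List.mem_map_of_mem hc)
  refine ⟨K.map fun c i => Fin.ofNat (n + 1) (c i), by simpa using hlen, ?_⟩
  rw [List.map_map]
  refine (List.map_congr_left fun c hc => ?_).trans (List.map_id K)
  ext i
  simp [Nat.mod_eq_of_lt (hle c hc i)]

end Mqs

/-- The product of two level-`l` monomial quasi-symmetric functions is a finite
linear combination, with nonnegative integer coefficients, of monomial functions
indexed by `l`-compositions whose weight is the sum of the two weights; hence the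
`M_I` span a subalgebra `QSym^(l)` of the power series ring. -/
theorem monomial_product_rule (l : ℕ) (hl : 1 ≤ l)
    (I J : List (Fin l → ℕ)) (hI : IsLComp l I) (hJ : IsLComp l J) :
    ∃ (S : Finset (List (Fin l → ℕ))) (coef : List (Fin l → ℕ) → ℕ),
      (∀ K ∈ S, IsLComp l K ∧ lcompWeight K = lcompWeight I + lcompWeight J) ∧
      Mqs l I * Mqs l J = ∑ K ∈ S, (coef K : MvPowerSeries (ℕ × ℕ) ℚ) * Mqs l K := by
  classical
  have hcoef (K : List (Fin l → ℕ)) : ∃ n : ℕ, ∀ d, Mqs.Occurs K d →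
      MvPowerSeries.coeff d (Mqs l I * Mqs l J) = n := by
    obtain ⟨n, hn⟩ := Mqs.exists_coeff_mul_eq_natCast I J (Mqs.exponent Fin.val K.get)
    refine ⟨n, ?_⟩
    rintro d ⟨j, hj, rfl⟩
    rw [← hn]
    exact Mqs.coeff_mul_exponent_congr hI hJ hj Fin.val_strictMono K.get
  choose coef hcoef using hcoef
  refine ⟨(Mqs.finite_isLComp_weight l (lcompWeight I + lcompWeight J)).toFinset, coef,
    fun K hK => by simpa using hK, ?_⟩
  ext d
  simp only [← nsmul_eq_mul, map_sum, map_nsmul, Mqs.coeff_eq]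
  by_cases h : ∃ K, (IsLComp l K ∧ lcompWeight K = lcompWeight I + lcompWeight J) ∧
      Mqs.Occurs K d
  · obtain ⟨K, hK, hd⟩ := h
    rw [Finset.sum_eq_single K, hcoef K d hd]
    · simp [hd]
    · intro L hL hne
      have hLcomp : IsLComp l L := ((Set.Finite.mem_toFinset _).1 hL).1
      rw [if_neg fun hLd => hne (hLd.eq hLcomp hK.1 hd), smul_zero]
    · exact fun hK' => absurd (((Mqs.finite_isLComp_weight l _).mem_toFinset).2 hK) hK'
  · rw [Finset.sum_eq_zero]
    · by_contra hne
      obtain ⟨a, b, rfl, ha, hb⟩ := Mqs.exists_occurs_of_coeff_mul_ne_zero hne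
      obtain ⟨K, hK, hd⟩ := Mqs.exists_isLComp_occurs (l := l) (d := a + b) fun p hp => by
        by_cases hap : a p = 0
        · exact hb.snd_lt (p := p) fun hbp => hp (by simp [hap, hbp])
        · exact ha.snd_lt hap
      refine h ⟨K, ⟨hK, ?_⟩, hd⟩
      rw [← hd.degree_eq, map_add, ha.degree_eq, hb.degree_eq]
    · intro K hK
      rw [if_neg fun hd => h ⟨K, (Mqs.finite_isLComp_weight l _).mem_toFinset.1 hK, hd⟩, smul_zero]
end

section
/- The family of level-l monomial quasi-symmetric functions {M_I}, indexed by all l-compositions (of all weights, including the empty one), is linearly independent over ℚ in the formal power series ring; hence it is a basis of the subalgebra QSym^(l) it spans. -/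
/-- The exponent of the monomial obtained by placing the columns `f k` in the positions `j k`. -/
noncomputable def columnExponent {l n : ℕ} (f : Fin n → Fin l → ℕ) (j : Fin n → ℕ) :
    ℕ × ℕ →₀ ℕ :=
  ∑ k : Fin n, ∑ c : Fin l, Finsupp.single (j k, (c : ℕ)) (f k c)

theorem columnExponent_apply {l n : ℕ} (f : Fin n → Fin l → ℕ) (j : Fin n → ℕ) (i : ℕ)
    (c : Fin l) : columnExponent f j (i, (c : ℕ)) = ∑ k : Fin n, if j k = i then f k c else 0 := by
  simp only [columnExponent, Finsupp.finsetSum_apply, Finsupp.single_apply, Prod.mk.injEq,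
    Fin.val_inj]
  refine Finset.sum_congr rfl fun k _ => ?_
  by_cases h : j k = i <;> simp [h]

theorem columnExponent_apply_self {l n : ℕ} (f : Fin n → Fin l → ℕ) {j : Fin n → ℕ}
    (hj : Function.Injective j) (k : Fin n) (c : Fin l) :
    columnExponent f j (j k, (c : ℕ)) = f k c := by
  simp [columnExponent_apply, hj.eq_iff]

theorem range_eq_setOf_columnExponent_ne_zero {l n : ℕ} {f : Fin n → Fin l → ℕ} {j : Fin n → ℕ}
    (hj : Function.Injective j) (hf : ∀ k, f k ≠ 0) :
    Set.range j = {i | ∃ c : Fin l, columnExponent f j (i, (c : ℕ)) ≠ 0} := by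
  ext i
  constructor
  · rintro ⟨k, rfl⟩
    obtain ⟨c, hc⟩ := Function.ne_iff.mp (hf k)
    exact ⟨c, by rwa [columnExponent_apply_self f hj]⟩
  · rintro ⟨c, hc⟩
    rw [columnExponent_apply] at hc
    obtain ⟨k, -, hk⟩ := Finset.exists_ne_zero_of_sum_ne_zero hc
    exact ⟨k, by by_contra h; simp [h] at hk⟩

/-- The sequence of nonzero columns can be read off from the exponent. -/
theorem ofFn_eq_of_columnExponent_eq {l n m : ℕ} {f : Fin n → Fin l → ℕ} {g : Fin m → Fin l → ℕ}
    {i : Fin n → ℕ} {j : Fin m → ℕ} (hf : ∀ k, f k ≠ 0) (hg : ∀ k, g k ≠ 0)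
    (hi : StrictMono i) (hj : StrictMono j) (h : columnExponent f i = columnExponent g j) :
    List.ofFn f = List.ofFn g := by
  have hr : Set.range i = Set.range j := by
    rw [range_eq_setOf_columnExponent_ne_zero hi.injective hf,
      range_eq_setOf_columnExponent_ne_zero hj.injective hg, h]
  obtain rfl : n = m := by
    simpa [Set.ncard_range_of_injective hi.injective, Set.ncard_range_of_injective hj.injective]
      using congrArg Set.ncard hr
  obtain rfl : i = j := (StrictMono.range_inj hi hj).mp hr
  congr 1
  ext k c
  rw [← columnExponent_apply_self f hi.injective, h, columnExponent_apply_self g hi.injective]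

theorem coeff_Mqs_columnExponent {l : ℕ} {L K : List (Fin l → ℕ)} (hL : IsLComp l L)
    (hK : IsLComp l K) [Decidable (K = L)] :
    MvPowerSeries.coeff (columnExponent L.get Fin.val) (Mqs l K) = if K = L then 1 else 0 := by
  classical
  rw [MvPowerSeries.coeff_apply, Mqs]
  refine if_congr ⟨?_, ?_⟩ rfl rfl
  · rintro ⟨j, hj, h⟩
    simpa using (ofFn_eq_of_columnExponent_eq (fun k => hL _ (L.get_mem k))
      (fun k => hK _ (K.get_mem k)) Fin.val_strictMono hj h).symm
  · rintro rfl
    exact ⟨Fin.val, Fin.val_strictMono, rfl⟩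

/-- The family of level-`l` monomial quasi-symmetric functions, indexed by all
`l`-compositions, is linearly independent over `ℚ`; hence it is a basis of the
subalgebra `QSym^(l)` it spans. -/
theorem monomial_linearIndependent (l : ℕ) (hl : 1 ≤ l) :
    LinearIndependent ℚ (fun I : {L : List (Fin l → ℕ) // IsLComp l L} => Mqs l I.1) := by
  classical
  refine LinearIndependent.of_pairwise_dual_eq_zero_one
    (fun I : {L : List (Fin l → ℕ) // IsLComp l L} => Mqs l I.1)
    (fun I => MvPowerSeries.coeff (columnExponent I.1.get Fin.val)) ?_ ?_
  · intro I J hIJ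
    rw [coeff_Mqs_columnExponent I.2 J.2, if_neg fun h => hIJ (Subtype.ext h.symm)]
  · intro I
    rw [coeff_Mqs_columnExponent I.2 I.2, if_pos rfl]
end
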